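/- arXiv:1106.4063 — 2 statements merged into one kernel-verified Lean document; each statement's English description precedes it below -/
import Mathlib

section
/- For every density matrix ρ₀, the program with initial state ρ₀ almost terminates (i.e. tr(E₁(Gⁿ⁻¹(ρ₀))) → 0 as n → ∞) if and only if the vectors Mⁿ · ((ρ₀ ⊗ I) · Φ) converge to the zero vector of ℂ^(d·d) as n → ∞. -/
open Matrix Kronecker Filter Topology
open scoped ComplexOrder

/-- The entries of a positive semidefinite matrix are bounded by its trace. -/
theorem Matrix.PosSemidef.norm_apply_le_norm_trace {n : Type*} [Fintype n]
    {X : Matrix n n ℂ} (hX : X.PosSemidef) (i j : n) : ‖X i j‖ ≤ ‖X.trace‖ := by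
  have hdiag (k : n) : ‖X k k‖ ≤ ‖X.trace‖ :=
    CStarAlgebra.norm_le_norm_of_nonneg_of_le hX.diag_nonneg
      (Finset.single_le_sum (f := fun k => X k k) (fun _ _ => hX.diag_nonneg) (Finset.mem_univ k))
  have hdet := (hX.submatrix ![i, j]).det_nonneg
  simp only [det_fin_two, submatrix_apply, Matrix.cons_val_zero, Matrix.cons_val_one,
    sub_nonneg] at hdet
  have hji : X j i = star (X i j) := (hX.isHermitian.apply j i).symm
  have hsq : 0 ≤ X i j * X j i := by
    rw [hji]
    exact mul_star_self_nonneg _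
  have hnorm := CStarAlgebra.norm_le_norm_of_nonneg_of_le hsq hdet
  rw [hji, norm_mul, norm_mul, norm_star] at hnorm
  refine abs_le_of_sq_le_sq' ?_ (norm_nonneg _) |>.2
  nlinarith [mul_le_mul (hdiag i) (hdiag j) (norm_nonneg _) (norm_nonneg _)]

/-- `A ⊗ B*` acts on row-major vectorizations as `X ↦ A X Bᴴ`. -/
theorem Matrix.kronecker_map_conj_mulVec {n : Type*} [Fintype n] (A B X : Matrix n n ℂ) :
    (A ⊗ₖ B.map (starRingEnd ℂ)) *ᵥ (fun p => X p.1 p.2) = fun p => (A * X * Bᴴ) p.1 p.2 := by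
  ext p
  simp only [mulVec, dotProduct, kroneckerMap_apply, map_apply, Fintype.sum_prod_type, mul_apply,
    conjTranspose_apply, Finset.sum_mul, starRingEnd_apply]
  rw [Finset.sum_comm]
  exact Finset.sum_congr rfl fun _ _ => Finset.sum_congr rfl fun _ _ => by ring

/-- Powers of the matrix representation of a Kraus map represent its iterates. -/
theorem Matrix.sum_kronecker_map_conj_pow_mulVec {n ι : Type*} [Fintype n] [DecidableEq n]
    [Fintype ι] (K : ι → Matrix n n ℂ) (X : Matrix n n ℂ) (k : ℕ) :
    ((∑ i, K i ⊗ₖ (K i).map (starRingEnd ℂ)) ^ k) *ᵥ (fun p => X p.1 p.2) =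
      fun p => ((fun ρ : Matrix n n ℂ => ∑ i, K i * ρ * (K i)ᴴ)^[k] X) p.1 p.2 := by
  induction k with
  | zero => simp
  | succ k ih =>
    rw [pow_succ', ← mulVec_mulVec, ih, Function.iterate_succ_apply', Matrix.sum_mulVec]
    ext p
    simp [kronecker_map_conj_mulVec, Matrix.sum_apply]

theorem Matrix.PosSemidef.iterate_kraus {n ι : Type*} [Fintype n] [Fintype ι]
    (K : ι → Matrix n n ℂ) {X : Matrix n n ℂ} (hX : X.PosSemidef) (k : ℕ) :
    ((fun ρ : Matrix n n ℂ => ∑ i, K i * ρ * (K i)ᴴ)^[k] X).PosSemidef := by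
  induction k with
  | zero => exact hX
  | succ k ih =>
    rw [Function.iterate_succ_apply']
    exact posSemidef_sum _ fun i _ => ih.mul_mul_conjTranspose_same (K i)

/-- A trace-preserving Kraus map does not change the trace after conjugation by `A`. -/
theorem Matrix.trace_sum_kraus_mul {n ι : Type*} [Fintype n] [DecidableEq n] [Fintype ι]
    (E : ι → Matrix n n ℂ) (hE : ∑ i, (E i)ᴴ * E i = 1) (A X : Matrix n n ℂ) :
    (∑ i, (E i * A) * X * (E i * A)ᴴ).trace = (A * X * Aᴴ).trace := by
  have h (i : ι) : ((E i * A) * X * (E i * A)ᴴ).trace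
      = ((E i)ᴴ * E i * (A * X * Aᴴ)).trace := by
    rw [Matrix.mul_assoc (E i)ᴴ, Matrix.trace_mul_comm (E i)ᴴ]
    simp only [conjTranspose_mul, Matrix.mul_assoc]
  rw [trace_sum, Finset.sum_congr rfl fun i _ => h i, ← trace_sum, ← Finset.sum_mul, hE,
    Matrix.one_mul]

theorem Matrix.kronecker_one_mulVec_maxEntangled {n : Type*} [Fintype n] [DecidableEq n]
    (X : Matrix n n ℂ) :
    (X ⊗ₖ (1 : Matrix n n ℂ)) *ᵥ (fun p : n × n => if p.1 = p.2 then (1 : ℂ) else 0) =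
      fun p => X p.1 p.2 := by
  ext p
  simp [mulVec, dotProduct, Fintype.sum_prod_type, Matrix.one_apply]

theorem stmt15 (d : ℕ) (hd : 0 < d) (ι : Type) [Fintype ι]
    (E : ι → Matrix (Fin d) (Fin d) ℂ) (hE : ∑ i, (E i)ᴴ * E i = 1)
    (M0 M1 : Matrix (Fin d) (Fin d) ℂ) (hM : M0ᴴ * M0 + M1ᴴ * M1 = 1)
    (ρ₀ : Matrix (Fin d) (Fin d) ℂ) (hρ₀ : ρ₀.PosSemidef) (htr : ρ₀.trace = 1) :
    Tendsto (fun n => (M1 * ((fun ρ : Matrix (Fin d) (Fin d) ℂ => ∑ i, (E i * M1) * ρ * (E i * M1)ᴴ)^[n - 1] ρ₀) * M1ᴴ).trace) atTop (nhds 0) ↔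
      Tendsto (fun n => ((∑ i, (E i * M1) ⊗ₖ (E i * M1).map (starRingEnd ℂ)) ^ n) *ᵥ ((ρ₀ ⊗ₖ (1 : Matrix (Fin d) (Fin d) ℂ)) *ᵥ (fun p : Fin d × Fin d => if p.1 = p.2 then (1 : ℂ) else 0))) atTop
        (nhds (0 : Fin d × Fin d → ℂ)) := by
  rw [kronecker_one_mulVec_maxEntangled]
  simp only [sum_kronecker_map_conj_pow_mulVec]
  set G := fun ρ : Matrix (Fin d) (Fin d) ℂ => ∑ i, (E i * M1) * ρ * (E i * M1)ᴴ
  have htrace : (fun n => (M1 * (G^[n - 1] ρ₀) * M1ᴴ).trace) =ᶠ[atTop]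
      fun n => (G^[n] ρ₀).trace := by
    filter_upwards [eventually_ge_atTop 1] with n hn
    obtain ⟨k, rfl⟩ := Nat.exists_eq_add_of_le' hn
    rw [Function.iterate_succ_apply', Nat.add_sub_cancel]
    exact (trace_sum_kraus_mul E hE M1 _).symm
  rw [tendsto_congr' htrace, tendsto_pi_nhds]
  constructor
  · intro h p
    exact squeeze_zero_norm
      (fun n => (hρ₀.iterate_kraus (fun i => E i * M1) n).norm_apply_le_norm_trace p.1 p.2)
      (tendsto_zero_iff_norm_tendsto_zero.mp h)
  · intro h
    simpa [Matrix.trace] using tendsto_finsetSum Finset.univ fun i _ => h (i, i)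
end

section
/- The program scheme is terminating, i.e. for every density matrix ρ there exists an integer n ≥ 1 with tr(E₁(Gⁿ⁻¹(ρ))) = 0, if and only if Mⁿ · Φ = 0 for some integer n ≥ 0. -/
open Matrix Kronecker Filter Topology
open scoped ComplexOrder

/-- The completely positive map `X ↦ ∑ i, K i * X * (K i)ᴴ` with Kraus operators `K`. -/
def krausMap {n ι : Type*} [Fintype n] [Fintype ι] (K : ι → Matrix n n ℂ) :
    Matrix n n ℂ →ₗ[ℂ] Matrix n n ℂ where
  toFun X := ∑ i, K i * X * (K i)ᴴ
  map_add' X Y := by simp [mul_add, add_mul, Finset.sum_add_distrib]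
  map_smul' c X := by simp [Finset.smul_sum]

section KrausMap

variable {n ι : Type*} [Fintype n] [Fintype ι]

lemma krausMap_apply (K : ι → Matrix n n ℂ) (X : Matrix n n ℂ) :
    krausMap K X = ∑ i, K i * X * (K i)ᴴ := rfl

lemma Matrix.PosSemidef.krausMap {X : Matrix n n ℂ} (hX : X.PosSemidef)
    (K : ι → Matrix n n ℂ) : (krausMap K X).PosSemidef :=
  posSemidef_sum _ fun i _ => hX.mul_mul_conjTranspose_same (K i)

lemma Matrix.PosSemidef.krausMap_pow {X : Matrix n n ℂ} (hX : X.PosSemidef)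
    (K : ι → Matrix n n ℂ) (k : ℕ) : ((_root_.krausMap K ^ k) X).PosSemidef := by
  induction k with
  | zero => simpa using hX
  | succ k ih =>
    rw [pow_succ', Module.End.mul_apply]
    exact ih.krausMap K

lemma sum_kronecker_mulVec (K : ι → Matrix n n ℂ) (X : Matrix n n ℂ) :
    (∑ i, K i ⊗ₖ (K i).map (starRingEnd ℂ)) *ᵥ (fun p => X p.1 p.2) =
      fun p => krausMap K X p.1 p.2 := by
  ext ⟨j, k⟩
  simp only [krausMap_apply, sum_mulVec, Finset.sum_apply, Matrix.sum_apply]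
  refine Finset.sum_congr rfl fun i _ => ?_
  simp only [mulVec, dotProduct, kroneckerMap_apply, Fintype.sum_prod_type, mul_apply,
    conjTranspose_apply, map_apply, Finset.sum_mul]
  rw [Finset.sum_comm]
  refine Finset.sum_congr rfl fun l _ => Finset.sum_congr rfl fun m _ => ?_
  rw [starRingEnd_apply]
  ring

variable [DecidableEq n]

lemma trace_krausMap_mul {E : ι → Matrix n n ℂ} (hE : ∑ i, (E i)ᴴ * E i = 1)
    (A X : Matrix n n ℂ) :
    (krausMap (fun i => E i * A) X).trace = (A * X * Aᴴ).trace := by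
  calc (krausMap (fun i => E i * A) X).trace
      = ∑ i, ((E i)ᴴ * E i * (A * X * Aᴴ)).trace := by
        rw [krausMap_apply, trace_sum]
        refine Finset.sum_congr rfl fun i _ => ?_
        rw [mul_assoc (E i)ᴴ, trace_mul_comm (E i)ᴴ]
        simp only [conjTranspose_mul, mul_assoc]
    _ = (A * X * Aᴴ).trace := by
        rw [← trace_sum, ← Finset.sum_mul, hE, one_mul]

lemma Matrix.PosSemidef.one_sub_of_trace_eq_one {ρ : Matrix n n ℂ} (hρ : ρ.PosSemidef)
    (htr : ρ.trace = 1) : (1 - ρ).PosSemidef := by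
  have hle (i : n) : hρ.1.eigenvalues i ≤ 1 := by
    have hsum : ∑ j, hρ.1.eigenvalues j = 1 := by
      have h := hρ.1.trace_eq_sum_eigenvalues
      rw [htr] at h
      exact Complex.ofReal_injective (by push_cast; exact h.symm)
    rw [← hsum]
    exact Finset.single_le_sum (fun j _ => hρ.eigenvalues_nonneg j) (Finset.mem_univ i)
  let U : Matrix n n ℂ := (hρ.1.eigenvectorUnitary).1
  have hUU : U * Uᴴ = 1 := Unitary.coe_mul_star_self hρ.1.eigenvectorUnitary
  have hspec : ρ = U * diagonal (fun i => (hρ.1.eigenvalues i : ℂ)) * Uᴴ := by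
    conv_lhs => rw [hρ.1.spectral_theorem]
    rfl
  have hdiag : (1 - diagonal (fun i => (hρ.1.eigenvalues i : ℂ)) : Matrix n n ℂ).PosSemidef := by
    rw [← diagonal_one, diagonal_sub, posSemidef_diagonal_iff]
    intro i
    exact sub_nonneg.2 (by exact_mod_cast hle i)
  have h := hdiag.mul_mul_conjTranspose_same U
  rwa [mul_sub, sub_mul, mul_one, hUU, ← hspec] at h

lemma krausMap_pow_eq_zero_of_one {K : ι → Matrix n n ℂ} {k : ℕ}
    (h : (krausMap K ^ k) 1 = 0) {ρ : Matrix n n ℂ} (hρ : ρ.PosSemidef)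
    (htr : ρ.trace = 1) : (krausMap K ^ k) ρ = 0 := by
  have hpos := hρ.krausMap_pow K k
  have hneg := (hρ.one_sub_of_trace_eq_one htr).krausMap_pow K k
  rw [map_sub, h, zero_sub] at hneg
  refine hpos.trace_eq_zero_iff.1 (le_antisymm ?_ hpos.trace_nonneg)
  simpa using hneg.trace_nonneg

lemma sum_kronecker_pow_mulVec (K : ι → Matrix n n ℂ) (X : Matrix n n ℂ) (k : ℕ) :
    ((∑ i, K i ⊗ₖ (K i).map (starRingEnd ℂ)) ^ k) *ᵥ (fun p => X p.1 p.2) =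
      fun p => (krausMap K ^ k) X p.1 p.2 := by
  induction k with
  | zero => simp
  | succ k ih =>
    rw [pow_succ', ← mulVec_mulVec, ih, sum_kronecker_mulVec, pow_succ', Module.End.mul_apply]

lemma sum_kronecker_pow_mulVec_eq_zero_iff (K : ι → Matrix n n ℂ) (k : ℕ) :
    ((∑ i, K i ⊗ₖ (K i).map (starRingEnd ℂ)) ^ k) *ᵥ
      (fun p : n × n => if p.1 = p.2 then (1 : ℂ) else 0) = 0 ↔ (krausMap K ^ k) 1 = 0 := by
  have h := sum_kronecker_pow_mulVec K 1 k
  simp only [one_apply] at h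
  rw [h]
  exact ⟨fun h0 => Matrix.ext fun i j => congrFun h0 (i, j), fun h0 => by rw [h0]; rfl⟩

end KrausMap

theorem stmt16 (d : ℕ) (hd : 0 < d) (ι : Type) [Fintype ι]
    (E : ι → Matrix (Fin d) (Fin d) ℂ) (hE : ∑ i, (E i)ᴴ * E i = 1)
    (M0 M1 : Matrix (Fin d) (Fin d) ℂ) (hM : M0ᴴ * M0 + M1ᴴ * M1 = 1) :
    (∀ ρ : Matrix (Fin d) (Fin d) ℂ, ρ.PosSemidef → ρ.trace = 1 →
        ∃ n : ℕ, 1 ≤ n ∧ (M1 * ((fun ρ : Matrix (Fin d) (Fin d) ℂ => ∑ i, (E i * M1) * ρ * (E i * M1)ᴴ)^[n - 1] ρ) * M1ᴴ).trace = 0) ↔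
      (∃ n : ℕ, ((∑ i, (E i * M1) ⊗ₖ (E i * M1).map (starRingEnd ℂ)) ^ n) *ᵥ (fun p : Fin d × Fin d => if p.1 = p.2 then (1 : ℂ) else 0) = 0) := by
  set K : ι → Matrix (Fin d) (Fin d) ℂ := fun i => E i * M1 with hK
  have hiter (n : ℕ) (ρ : Matrix (Fin d) (Fin d) ℂ) :
      (fun ρ : Matrix (Fin d) (Fin d) ℂ => ∑ i, (E i * M1) * ρ * (E i * M1)ᴴ)^[n] ρ =
        (krausMap K ^ n) ρ := by
    rw [Module.End.pow_apply]
    rfl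
  simp only [hiter, sum_kronecker_pow_mulVec_eq_zero_iff fun i => E i * M1, ← hK]
  have hd0 : (d : ℂ) ≠ 0 := by exact_mod_cast hd.ne'
  constructor
  · intro h
    have hpos : ((d : ℂ)⁻¹ • (1 : Matrix (Fin d) (Fin d) ℂ)).PosSemidef :=
      PosSemidef.one.smul (inv_nonneg.2 (Nat.cast_nonneg d))
    obtain ⟨n, -, hn⟩ := h _ hpos (by simp [hd0])
    refine ⟨n - 1 + 1, ?_⟩
    rw [← trace_krausMap_mul hE, ← hK, ← Module.End.mul_apply, ← pow_succ',
      (hpos.krausMap_pow K _).trace_eq_zero_iff, map_smul] at hn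
    exact (smul_eq_zero.1 hn).resolve_left (inv_ne_zero hd0)
  · rintro ⟨n, hn⟩ ρ hρ htr
    refine ⟨n + 1, Nat.le_add_left 1 n, ?_⟩
    simp [krausMap_pow_eq_zero_of_one hn hρ htr]
end
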